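/- Let G be a group acting on a set E, and let α : G × E → {1, −1} be a map satisfying α(gh, e) = α(g, h·e)·α(h, e) and α(1, e) = 1 for all g, h ∈ G and e ∈ E, so that setting g·[e] = α(g,e)·[g·e] on basis vectors defines a ℚ-linear representation of G on the free ℚ-vector space ℚ[E]. Then the coinvariants ℚ[E]_G (the quotient of ℚ[E] by the subspace spanned by all x − g·x) are isomorphic, as a ℚ-vector space, to the free ℚ-vector space ℚ[E'/G] on the set of G-orbits of E' = { e ∈ E | for all g ∈ G with g·e = e, one has α(g,e) = 1 } (a G-stable subset of E). -/

import Mathlib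

noncomputable section

variable {G : Type*} [Group G] {E : Type*} [MulAction G E]

/-- The `ℚ`-linear endomorphism of `ℚ[E]` given on basis vectors by
`g · [e] = α(g,e) · [g · e]`. -/
def twistedMap (α : G → E → ℚ) (g : G) : (E →₀ ℚ) →ₗ[ℚ] (E →₀ ℚ) :=
  Finsupp.lsum ℚ (fun e => α g e • Finsupp.lsingle (g • e))

/-- The subspace of `ℚ[E]` spanned by the elements `v - g·v`; the quotient by it is the
space of coinvariants `ℚ[E]_G`. -/
def coinvariantsRel (α : G → E → ℚ) : Submodule ℚ (E →₀ ℚ) :=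
  Submodule.span ℚ {x | ∃ (g : G) (v : E →₀ ℚ), x = v - twistedMap α g v}

/-- The subset `E' = {e ∈ E | ∀ g ∈ G, g·e = e → α(g,e) = 1}` of `E`
(it is a `G`-stable subset). -/
abbrev goodSet (α : G → E → ℚ) : Type _ :=
  {e : E // ∀ g : G, g • e = e → α g e = 1}

/-- The setoid on `E'` whose equivalence classes are the `G`-orbits. -/
def orbitSetoid (α : G → E → ℚ) : Setoid (goodSet α) where
  r x y := ∃ g : G, g • (x : E) = (y : E)
  iseqv :=
    ⟨fun _ => ⟨1, one_smul _ _⟩,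
     fun ⟨g, hg⟩ => ⟨g⁻¹, by rw [← hg, inv_smul_smul]⟩,
     fun ⟨g, hg⟩ ⟨h, hh⟩ => ⟨h * g, by rw [mul_smul, hg, hh]⟩⟩

theorem twistedMap_single (α : G → E → ℚ) (g : G) (e : E) (c : ℚ) :
    twistedMap α g (Finsupp.single e c) = Finsupp.single (g • e) (α g e * c) := by
  simp [twistedMap]

theorem mkQ_single_smul (α : G → E → ℚ) (g : G) (e : E) :
    (coinvariantsRel α).mkQ (Finsupp.single e 1) =
      α g e • (coinvariantsRel α).mkQ (Finsupp.single (g • e) 1) := by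
  rw [← map_smul, ← sub_eq_zero, ← map_sub, Submodule.mkQ_apply, Submodule.Quotient.mk_eq_zero]
  exact Submodule.subset_span ⟨g, Finsupp.single e 1, by simp [twistedMap_single]⟩

theorem mkQ_single_eq_zero (α : G → E → ℚ) {g : G} {e : E} (hge : g • e = e)
    (hg : α g e = -1) : (coinvariantsRel α).mkQ (Finsupp.single e 1) = 0 := by
  have h := mkQ_single_smul α g e
  rw [hge, hg, neg_one_smul] at h
  rw [eq_neg_iff_add_eq_zero, ← two_smul ℚ] at h
  exact (smul_eq_zero.mp h).resolve_left two_ne_zero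

theorem sign_eq_of_smul_eq {α : G → E → ℚ} (hone : ∀ e : E, α 1 e = 1)
    (hmul : ∀ (g h : G) (e : E), α (g * h) e = α g (h • e) * α h e)
    {e : E} (he : ∀ g : G, g • e = e → α g e = 1) {a b : G} (hab : a • e = b • e) :
    α a e = α b e := by
  have ha : α b⁻¹ (b • e) * α a e = 1 := by
    rw [← hab, ← hmul]
    exact he _ (by rw [mul_smul, hab, inv_smul_smul])
  have hb : α b⁻¹ (b • e) * α b e = 1 := by rw [← hmul, inv_mul_cancel, hone]
  exact mul_left_cancel₀ (left_ne_zero_of_mul_eq_one hb) (ha.trans hb.symm)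

theorem sign_eq_one_smul {α : G → E → ℚ} (hone : ∀ e : E, α 1 e = 1)
    (hmul : ∀ (g h : G) (e : E), α (g * h) e = α g (h • e) * α h e)
    {e : E} (he : ∀ g : G, g • e = e → α g e = 1) (h : G) :
    ∀ g : G, g • h • e = h • e → α g (h • e) = 1 := by
  intro g hg
  have h1 : α (g * h) e = α h e := sign_eq_of_smul_eq hone hmul he (by rw [mul_smul, hg])
  have h2 : α h⁻¹ (h • e) * α h e = 1 := by rw [← hmul, inv_mul_cancel, hone]
  rw [hmul] at h1
  exact mul_right_cancel₀ (right_ne_zero_of_mul_eq_one h2) (h1.trans (one_mul _).symm)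

theorem exists_smul_out_eq (α : G → E → ℚ) (x : goodSet α) :
    ∃ g : G, g • ((Quotient.mk (orbitSetoid α) x).out : E) = x :=
  Quotient.mk_out (s := orbitSetoid α) x

/-- An element of `G` carrying the chosen representative of the orbit of `x` to `x`. -/
def transporter (α : G → E → ℚ) (x : goodSet α) : G :=
  (exists_smul_out_eq α x).choose

theorem transporter_smul (α : G → E → ℚ) (x : goodSet α) :
    transporter α x • ((Quotient.mk (orbitSetoid α) x).out : E) = x :=
  (exists_smul_out_eq α x).choose_spec

open Classical in
/-- The linear map `ℚ[E] → ℚ[E'/G]` killing the basis vectors outside `E'` and sending `[e]`,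
for `e ∈ E'`, to its orbit, up to the sign relating `e` to the chosen representative. -/
def toOrbits (α : G → E → ℚ) : (E →₀ ℚ) →ₗ[ℚ] (Quotient (orbitSetoid α) →₀ ℚ) :=
  Finsupp.linearCombination ℚ fun e =>
    if he : ∀ g : G, g • e = e → α g e = 1 then
      Finsupp.single (Quotient.mk (orbitSetoid α) ⟨e, he⟩)
        (α (transporter α ⟨e, he⟩) (Quotient.mk (orbitSetoid α) ⟨e, he⟩).out)
    else 0

theorem toOrbits_single (α : G → E → ℚ) (x : goodSet α) :
    toOrbits α (Finsupp.single (x : E) 1) = Finsupp.single (Quotient.mk (orbitSetoid α) x)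
      (α (transporter α x) (Quotient.mk (orbitSetoid α) x).out) := by
  rw [toOrbits, Finsupp.linearCombination_single, one_smul, dif_pos x.2]

theorem toOrbits_single_of_not (α : G → E → ℚ) {e : E}
    (he : ¬ ∀ g : G, g • e = e → α g e = 1) : toOrbits α (Finsupp.single e 1) = 0 := by
  rw [toOrbits, Finsupp.linearCombination_single, one_smul, dif_neg he]

theorem toOrbits_single_smul {α : G → E → ℚ}
    (hval : ∀ (g : G) (e : E), α g e = 1 ∨ α g e = -1) (hone : ∀ e : E, α 1 e = 1)
    (hmul : ∀ (g h : G) (e : E), α (g * h) e = α g (h • e) * α h e) (g : G) (e : E) :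
    α g e • toOrbits α (Finsupp.single (g • e) 1) = toOrbits α (Finsupp.single e 1) := by
  by_cases he : ∀ g : G, g • e = e → α g e = 1
  · have hge := sign_eq_one_smul hone hmul he g
    have hq : Quotient.mk (orbitSetoid α) ⟨g • e, hge⟩ = Quotient.mk (orbitSetoid α) ⟨e, he⟩ :=
      Quotient.sound (s := orbitSetoid α) ⟨g⁻¹, inv_smul_smul g e⟩
    have h1 := toOrbits_single α ⟨g • e, hge⟩
    have h2 := toOrbits_single α ⟨e, he⟩
    have t1 := transporter_smul α ⟨g • e, hge⟩
    have t2 := transporter_smul α ⟨e, he⟩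
    rw [hq] at h1 t1
    simp only at h1 h2 t1 t2
    have hs := sign_eq_of_smul_eq hone hmul (Quotient.mk (orbitSetoid α) ⟨e, he⟩).out.2
      (a := transporter α ⟨g • e, hge⟩) (b := g * transporter α ⟨e, he⟩)
      (by rw [mul_smul, t1, t2])
    rw [hmul, t2] at hs
    rw [h1, h2, hs, Finsupp.smul_single, smul_eq_mul, ← mul_assoc,
      mul_self_eq_one_iff.mpr (hval g e), one_mul]
  · rw [toOrbits_single_of_not α he, toOrbits_single_of_not α, smul_zero]
    intro hge
    have := sign_eq_one_smul hone hmul hge g⁻¹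
    rw [inv_smul_smul] at this
    exact he this

theorem coinvariantsRel_le_ker_toOrbits {α : G → E → ℚ}
    (hval : ∀ (g : G) (e : E), α g e = 1 ∨ α g e = -1) (hone : ∀ e : E, α 1 e = 1)
    (hmul : ∀ (g h : G) (e : E), α (g * h) e = α g (h • e) * α h e) :
    coinvariantsRel α ≤ LinearMap.ker (toOrbits α) := by
  refine Submodule.span_le.mpr ?_
  rintro _ ⟨g, v, rfl⟩
  have h : toOrbits α ∘ₗ twistedMap α g = toOrbits α := by
    ext1 e
    ext1
    simp only [LinearMap.comp_apply, Finsupp.lsingle_apply]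
    rw [twistedMap_single, ← toOrbits_single_smul hval hone hmul g e, ← map_smul,
      Finsupp.smul_single, smul_eq_mul]
  rw [SetLike.mem_coe, LinearMap.mem_ker, map_sub, sub_eq_zero]
  exact (LinearMap.congr_fun h v).symm

/-- The linear map `ℚ[E'/G] → ℚ[E]_G` sending an orbit to the class of its chosen
representative. -/
def ofOrbits (α : G → E → ℚ) :
    (Quotient (orbitSetoid α) →₀ ℚ) →ₗ[ℚ] ((E →₀ ℚ) ⧸ coinvariantsRel α) :=
  Finsupp.linearCombination ℚ fun q => (coinvariantsRel α).mkQ (Finsupp.single (q.out : E) 1)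

theorem ofOrbits_single (α : G → E → ℚ) (q : Quotient (orbitSetoid α)) (c : ℚ) :
    ofOrbits α (Finsupp.single q c) =
      c • (coinvariantsRel α).mkQ (Finsupp.single (q.out : E) 1) :=
  Finsupp.linearCombination_single ℚ c q

theorem toOrbits_single_out {α : G → E → ℚ} (q : Quotient (orbitSetoid α)) :
    toOrbits α (Finsupp.single (q.out : E) 1) = Finsupp.single q 1 := by
  have t := transporter_smul α q.out
  rw [toOrbits_single]
  rw [Quotient.out_eq] at t ⊢
  rw [q.out.2 _ t]

theorem ofOrbits_toOrbits_single {α : G → E → ℚ}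
    (hval : ∀ (g : G) (e : E), α g e = 1 ∨ α g e = -1) (e : E) :
    ofOrbits α (toOrbits α (Finsupp.single e 1)) =
      (coinvariantsRel α).mkQ (Finsupp.single e 1) := by
  by_cases he : ∀ g : G, g • e = e → α g e = 1
  · rw [toOrbits_single α ⟨e, he⟩, ofOrbits_single,
      mkQ_single_smul α (transporter α ⟨e, he⟩), transporter_smul, smul_smul,
      mul_self_eq_one_iff.mpr (hval _ _), one_smul]
  · rw [toOrbits_single_of_not α he, map_zero]
    push Not at he
    obtain ⟨g, hge, hg⟩ := he
    exact (mkQ_single_eq_zero α hge ((hval g e).resolve_left hg)).symm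

/-- Let `G` act on a set `E` and let `α : G × E → {1, -1}` be such that
`g · [e] = α(g,e) [g·e]` defines a `ℚ`-linear representation of `G` on `ℚ[E]`.  Then the
coinvariants `ℚ[E]_G` are isomorphic, as a `ℚ`-vector space, to the free vector space
`ℚ[E'/G]` on the set of `G`-orbits of
`E' = {e ∈ E | ∀ g ∈ G, g·e = e → α(g,e) = 1}`. -/
theorem coinvariants_iso_orbits
    (α : G → E → ℚ)
    (hval : ∀ (g : G) (e : E), α g e = 1 ∨ α g e = -1)
    (hone : ∀ e : E, α 1 e = 1)
    (hmul : ∀ (g h : G) (e : E), α (g * h) e = α g (h • e) * α h e) :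
    Nonempty (((E →₀ ℚ) ⧸ coinvariantsRel α) ≃ₗ[ℚ]
      (Quotient (orbitSetoid α) →₀ ℚ)) := by
  refine ⟨LinearEquiv.ofLinearMap
    ((coinvariantsRel α).liftQ (toOrbits α) (coinvariantsRel_le_ker_toOrbits hval hone hmul))
    (ofOrbits α) ?_ ?_⟩
  · ext1 q
    ext1
    simp only [LinearMap.comp_apply, Finsupp.lsingle_apply, LinearMap.id_apply]
    rw [ofOrbits_single, one_smul, Submodule.mkQ_apply, Submodule.liftQ_apply,
      toOrbits_single_out]
  · refine Submodule.linearMap_qext _ ?_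
    ext1 e
    ext1
    exact ofOrbits_toOrbits_single hval e
end
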